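/- Let R be a λ-ring with an augmentation ε : R → ℤ which is a ring homomorphism commuting with the λ-operations, and let F^m R denote the γ-filtration. Then: F^{m+1} R ⊆ F^m R for all m ≥ 0; F^1 R ⊆ F^0 R = R; F^m R · F^{m'} R ⊆ F^{m+m'} R for all m, m' ≥ 0; and for each m ≥ 1, F^m R is an ideal of R which is stable under all the operations λ^n for n ≥ 1 (a λ-ideal). -/

import Mathlib

open Finset MvPolynomial

/-- The `n`-th elementary symmetric function of the family `f` restricted to the finite set `s`. -/
noncomputable def esymmAt {ι A : Type*} [CommRing A] (s : Finset ι) (n : ℕ) (f : ι → A) : A :=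
  ∑ t ∈ s.powersetCard n, ∏ i ∈ t, f i

/-- `IsPk k P` says that `P` is the universal integer polynomial in `2k` variables with
`P(e_1(x),…,e_k(x); e_1(y),…,e_k(y))` equal to the `k`-th elementary symmetric polynomial of
the `k²` products `x_i·y_j`. -/
def IsPk (k : ℕ) (P : MvPolynomial (Fin k ⊕ Fin k) ℤ) : Prop :=
  aeval (Sum.elim
      (fun i : Fin k => esymmAt Finset.univ (i.1 + 1)
        (fun j : Fin k => (X (Sum.inl j) : MvPolynomial (Fin k ⊕ Fin k) ℤ)))
      (fun i : Fin k => esymmAt Finset.univ (i.1 + 1)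
        (fun j : Fin k => (X (Sum.inr j) : MvPolynomial (Fin k ⊕ Fin k) ℤ)))) P
    = esymmAt Finset.univ k
      (fun p : Fin k × Fin k =>
        (X (Sum.inl p.1) : MvPolynomial (Fin k ⊕ Fin k) ℤ) * X (Sum.inr p.2))

/-- `IsPkl k m Q` says that `Q` is the universal integer polynomial in `k·m` variables with
`Q(e_1(x),…,e_{km}(x))` equal to the `k`-th elementary symmetric polynomial of the products
`x_{i_1}⋯x_{i_m}` over all `m`-element subsets of `{1,…,km}`. -/
def IsPkl (k m : ℕ) (Q : MvPolynomial (Fin (k * m)) ℤ) : Prop :=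
  aeval (fun i : Fin (k * m) => esymmAt Finset.univ (i.1 + 1)
      (fun j : Fin (k * m) => (X j : MvPolynomial (Fin (k * m)) ℤ))) Q
    = esymmAt (Finset.univ.powersetCard m) k
      (fun t : Finset (Fin (k * m)) => ∏ i ∈ t, (X i : MvPolynomial (Fin (k * m)) ℤ))

/-- A λ-ring structure (in the sense of Grothendieck, i.e. a "special" λ-ring) on the
commutative ring `R`, given by operations `l n : R → R`. -/
structure IsLambdaRing {R : Type*} [CommRing R] (l : ℕ → R → R) : Prop where
  map_zero : ∀ r, l 0 r = 1
  map_one : ∀ r, l 1 r = r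
  add_eq : ∀ (n : ℕ) (r s : R), l n (r + s) = ∑ i ∈ Finset.range (n + 1), l i r * l (n - i) s
  one_eq : ∀ n, 1 < n → l n (1 : R) = 0
  mul_eq : ∀ k, 1 ≤ k → ∀ P : MvPolynomial (Fin k ⊕ Fin k) ℤ, IsPk k P →
    ∀ r s : R, l k (r * s) =
      aeval (Sum.elim (fun i : Fin k => l (i.1 + 1) r) (fun j : Fin k => l (j.1 + 1) s)) P
  comp_eq : ∀ k m, 1 ≤ k → 1 ≤ m → ∀ Q : MvPolynomial (Fin (k * m)) ℤ, IsPkl k m Q →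
    ∀ r : R, l k (l m r) = aeval (fun i : Fin (k * m) => l (i.1 + 1) r) Q

/-- The γ-operations of a (pre-)λ-ring: `γ^n(x) = λ^n(x + (n-1)·1)` (note that for `n = 0`
this gives `γ^0(x) = λ^0(x) = 1`). -/
noncomputable def gammaOp {R : Type*} [CommRing R] (l : ℕ → R → R) (n : ℕ) (x : R) : R :=
  l n (x + ((n - 1 : ℕ) : R))

/-- The γ-filtration of an augmented λ-ring: `F^0 R = R`, and for `m ≥ 1`, `F^m R` is the
additive subgroup generated by the products `γ^{i_1}(x_1)⋯γ^{i_p}(x_p)` with `p ≥ 1`,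
`i_j ≥ 1`, `x_j ∈ ker ε` and `i_1 + ⋯ + i_p ≥ m`. -/
noncomputable def gammaFil {R : Type*} [CommRing R] (l : ℕ → R → R) (ε : R →+* ℤ) :
    ℕ → AddSubgroup R
  | 0 => ⊤
  | m + 1 => AddSubgroup.closure
      {x : R | ∃ (p : ℕ) (is : Fin (p + 1) → ℕ) (a : Fin (p + 1) → R),
        (∀ j, 1 ≤ is j) ∧ (∀ j, ε (a j) = 0) ∧ (m + 1 ≤ ∑ j, is j) ∧
        x = ∏ j, gammaOp l (is j) (a j)}

section Esymm

variable {ι κ A B : Type*} [CommRing A] [CommRing B]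

lemma map_esymmAt (φ : A →+* B) (s : Finset ι) (n : ℕ) (f : ι → A) :
    φ (esymmAt s n f) = esymmAt s n (fun i => φ (f i)) := by
  simp [esymmAt, map_sum, map_prod]

lemma esymmAt_map (e : ι ↪ κ) (s : Finset ι) (n : ℕ) (f : κ → A) :
    esymmAt (s.map e) n f = esymmAt s n (fun i => f (e i)) := by
  simp [esymmAt, Finset.powersetCard_map]

lemma esymmAt_congr {s : Finset ι} {n : ℕ} {f g : ι → A} (h : ∀ i ∈ s, f i = g i) :
    esymmAt s n f = esymmAt s n g :=
  Finset.sum_congr rfl fun _ ht => Finset.prod_congr rfl fun i hi =>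
    h i ((Finset.mem_powersetCard.1 ht).1 hi)

lemma esymmAt_of_subset {s t : Finset ι} (hst : s ⊆ t) {f : ι → A}
    (h : ∀ i ∈ t, i ∉ s → f i = 0) (n : ℕ) : esymmAt t n f = esymmAt s n f := by
  symm
  refine Finset.sum_subset (Finset.powersetCard_mono hst) fun u hu hu' => ?_
  rw [Finset.mem_powersetCard] at hu hu'
  obtain ⟨i, hi, his⟩ := Finset.not_subset.1 fun hus => hu' ⟨hus, hu.2⟩
  exact Finset.prod_eq_zero hi (h i (hu.1 hi) his)

lemma esymmAt_eq_zero_of_card_lt {s : Finset ι} {n : ℕ} (h : s.card < n) (f : ι → A) :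
    esymmAt s n f = 0 := by
  rw [esymmAt, Finset.powersetCard_eq_empty.2 h, Finset.sum_empty]

lemma esymmAt_zero_fun (s : Finset ι) {n : ℕ} (hn : 0 < n) :
    esymmAt s n (fun _ => (0 : A)) = 0 := by
  rw [esymmAt_of_subset (Finset.empty_subset s) (fun _ _ _ => rfl)]
  exact esymmAt_eq_zero_of_card_lt (by simpa using hn) _

lemma esymmAt_const_mul (s : Finset ι) (n : ℕ) (c : A) (f : ι → A) :
    esymmAt s n (fun i => c * f i) = esymmAt s n f * c ^ n := by
  rw [esymmAt, esymmAt, Finset.sum_mul]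
  refine Finset.sum_congr rfl fun t ht => ?_
  rw [Finset.prod_mul_distrib, Finset.prod_const, (Finset.mem_powersetCard.1 ht).2, mul_comm]

lemma prod_one_add_eq_sum_esymmAt (s : Finset ι) (f : ι → A) :
    ∏ i ∈ s, (1 + Polynomial.C (f i) * Polynomial.X) =
      ∑ n ∈ Finset.range (s.card + 1),
        Polynomial.C (esymmAt s n f) * Polynomial.X ^ n := by
  rw [Finset.prod_one_add, Finset.sum_powerset]
  refine Finset.sum_congr rfl fun n _ => ?_
  rw [esymmAt, map_sum, Finset.sum_mul]
  refine Finset.sum_congr rfl fun t ht => ?_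
  rw [Finset.prod_mul_distrib, Finset.prod_const, (Finset.mem_powersetCard.1 ht).2, map_prod]

lemma coeff_prod_one_add (s : Finset ι) (f : ι → A) (n : ℕ) :
    (∏ i ∈ s, (1 + Polynomial.C (f i) * Polynomial.X)).coeff n = esymmAt s n f := by
  rw [prod_one_add_eq_sum_esymmAt, Polynomial.finsetSum_coeff]
  simp only [Polynomial.coeff_C_mul_X_pow]
  rw [Finset.sum_ite_eq]
  split_ifs with h
  · rfl
  · exact (esymmAt_eq_zero_of_card_lt (by simpa using h) f).symm

lemma exists_aeval_esymmAt_eq {n : ℕ} {p : MvPolynomial (Fin n) A} (hp : p.IsSymmetric) :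
    ∃ q : MvPolynomial (Fin n) A,
      aeval (fun i : Fin n => esymmAt Finset.univ (i.1 + 1)
        (fun j : Fin n => (X j : MvPolynomial (Fin n) A))) q = p := by
  obtain ⟨q, hq⟩ := MvPolynomial.esymmAlgHom_fin_surjective A (le_refl n) ⟨p, hp⟩
  exact ⟨q, by rw [← show (esymmAlgHom (Fin n) A n q).1 = p from congrArg Subtype.val hq,
    esymmAlgHom_apply]; rfl⟩

lemma eq_zero_of_aeval_esymmAt_eq_zero {n : ℕ} {q : MvPolynomial (Fin n) A}
    (hq : aeval (fun i : Fin n => esymmAt Finset.univ (i.1 + 1)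
      (fun j : Fin n => (X j : MvPolynomial (Fin n) A))) q = 0) : q = 0 := by
  apply MvPolynomial.esymmAlgHom_fin_injective A (le_refl n)
  apply Subtype.ext
  rw [esymmAlgHom_apply, map_zero]
  exact hq

/-- If the substitution `φ` kills the variables in `s`, retains the others up to renaming, and
annihilates `P` after evaluation at elementary symmetric polynomials, then `P` lies in the ideal
generated by the variables in `s`. -/
lemma mem_span_X_of_aeval_esymmAt {σ : Type*} {n : ℕ} {s : Set σ} {P : MvPolynomial σ ℤ}
    (g : Fin n → σ) (φ : σ → MvPolynomial (Fin n) ℤ) (hs : ∀ i ∈ s, φ i = 0)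
    (hg : ∀ i ∉ s, rename g (φ i) = X i)
    (hP : aeval (fun i => aeval (fun i : Fin n => esymmAt Finset.univ (i.1 + 1)
        (fun j : Fin n => (X j : MvPolynomial (Fin n) ℤ))) (φ i)) P = 0) :
    P ∈ Ideal.span (X '' s : Set (MvPolynomial σ ℤ)) := by
  have h0 : aeval φ P = 0 := by
    apply eq_zero_of_aeval_esymmAt_eq_zero
    rw [← AlgHom.comp_apply, comp_aeval]
    exact hP
  have h1 : ((Ideal.Quotient.mkₐ ℤ (Ideal.span (X '' s : Set (MvPolynomial σ ℤ)))).comp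
      ((rename g).comp (aeval φ))) = Ideal.Quotient.mkₐ ℤ _ := by
    refine MvPolynomial.algHom_ext fun i => ?_
    simp only [AlgHom.comp_apply, aeval_X]
    by_cases hi : i ∈ s
    · rw [hs i hi, map_zero, map_zero, eq_comm, Ideal.Quotient.mkₐ_eq_mk,
        Ideal.Quotient.eq_zero_iff_mem]
      exact Ideal.subset_span ⟨i, hi, rfl⟩
    · rw [hg i hi]
  rw [← Ideal.Quotient.eq_zero_iff_mem, ← Ideal.Quotient.mkₐ_eq_mk ℤ, ← h1,
    AlgHom.comp_apply, AlgHom.comp_apply, h0, map_zero, map_zero]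

end Esymm

section UniversalPolynomials

lemma exists_isPkl (k m : ℕ) : ∃ Q, IsPkl k m Q := by
  refine exists_aeval_esymmAt_eq fun e => ?_
  have h := map_esymmAt (rename e : MvPolynomial (Fin (k * m)) ℤ →ₐ[ℤ] _).toRingHom
    (Finset.univ.powersetCard m) k
    (fun t : Finset (Fin (k * m)) => ∏ i ∈ t, (X i : MvPolynomial (Fin (k * m)) ℤ))
  refine h.trans ?_
  have h2 : (Finset.univ : Finset (Fin (k * m))).powersetCard m =
      (Finset.univ.powersetCard m).map (Finset.mapEmbedding e.toEmbedding).toEmbedding := by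
    rw [← Finset.powersetCard_map, Finset.map_univ_equiv]
  conv_rhs => rw [h2, esymmAt_map]
  exact esymmAt_congr fun t _ => by simp

lemma exists_isPk (k : ℕ) : ∃ P, IsPk k P := by
  classical
  let S := MvPolynomial (Fin k ⊕ Fin k) ℤ
  let ey : ℕ → S := fun n => esymmAt Finset.univ n (fun j : Fin k => X (Sum.inr j))
  let E : ℕ → MvPolynomial (Fin k) ℤ := fun a =>
    if h : a - 1 < k then if a = 0 then 1 else X ⟨a - 1, h⟩ else if a = 0 then 1 else 0
  let α : MvPolynomial (Fin k) ℤ →ₐ[ℤ] S := aeval fun i : Fin k => ey (i.1 + 1)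
  have hα : ∀ a ∈ Finset.range (k + 1), α (E a) = ey a := by
    rintro (_ | a) ha
    · simp [E, ey, esymmAt]
    · have : a < k := by simpa using ha
      simp [E, α, this]
  let G : Polynomial (MvPolynomial (Fin k) (MvPolynomial (Fin k) ℤ)) :=
    ∏ i : Fin k, ∑ a ∈ Finset.range (k + 1), Polynomial.C (C (E a) * X i ^ a) * Polynomial.X ^ a
  have hG : (G.coeff k).IsSymmetric := fun e => by
    have : G.map (rename e : _ →ₐ[MvPolynomial (Fin k) ℤ] _).toRingHom = G := by
      simp only [G, Polynomial.map_prod, Polynomial.map_sum, Polynomial.map_mul,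
        Polynomial.map_pow, Polynomial.map_X, Polynomial.map_C]
      rw [← Equiv.prod_comp e (fun i => ∑ a ∈ Finset.range (k + 1),
        Polynomial.C (C (E a) * X i ^ a) * Polynomial.X ^ a)]
      simp
    conv_rhs => rw [← this, Polynomial.coeff_map]
    rfl
  obtain ⟨p, hp⟩ := exists_aeval_esymmAt_eq hG
  let Φ : MvPolynomial (Fin k) (MvPolynomial (Fin k) ℤ) →+* S :=
    eval₂Hom α.toRingHom (fun i => X (Sum.inl i))
  let Ψ : MvPolynomial (Fin k) (MvPolynomial (Fin k) ℤ) →+* S :=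
    eval₂Hom (rename Sum.inr : _ →ₐ[ℤ] S).toRingHom (fun i => X (Sum.inl i))
  have h1 : ((aeval (Sum.elim
      (fun i : Fin k => esymmAt Finset.univ (i.1 + 1) (fun j : Fin k => (X (Sum.inl j) : S)))
      (fun i : Fin k => ey (i.1 + 1)))).toRingHom : S →+* S).comp Ψ =
      Φ.comp (aeval (fun i : Fin k => esymmAt Finset.univ (i.1 + 1)
        (fun j : Fin k => (X j : MvPolynomial (Fin k) (MvPolynomial (Fin k) ℤ))))).toRingHom := by
    refine MvPolynomial.ringHom_ext' (MvPolynomial.ringHom_ext' (RingHom.ext_int _ _) ?_) ?_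
    · intro i
      simp [Φ, Ψ, α]
    · intro i
      simp [Ψ, map_esymmAt Φ, -coe_eval₂Hom]
      simp [Φ]
  refine ⟨Ψ p, (RingHom.congr_fun h1 p).trans ?_⟩
  change Φ (aeval _ p) = _
  rw [hp, ← Polynomial.coeff_map, ← coeff_prod_one_add, ← Finset.univ_product_univ,
    Finset.prod_product]
  congr 1
  simp only [G, Polynomial.map_prod, Polynomial.map_sum, Polynomial.map_mul,
        Polynomial.map_pow, Polynomial.map_X, Polynomial.map_C]
  refine Finset.prod_congr rfl fun i _ => ?_
  have h2 := prod_one_add_eq_sum_esymmAt (Finset.univ : Finset (Fin k))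
    (fun j => (X (Sum.inl i) * X (Sum.inr j) : S))
  refine Eq.trans ?_ h2.symm
  rw [Finset.card_univ, Fintype.card_fin]
  refine Finset.sum_congr rfl fun a ha => ?_
  have h3 : Φ (C (E a) * X i ^ a) =
      esymmAt Finset.univ a (fun j => (X (Sum.inl i) * X (Sum.inr j) : S)) := by
    rw [map_mul, map_pow]
    simp only [Φ, coe_eval₂Hom, eval₂_C, eval₂_X]
    change α (E a) * _ = _
    rw [hα a ha]
    exact (esymmAt_const_mul _ _ _ _).symm
  rw [h3]

lemma IsPk.mem_span_inl {k : ℕ} (hk : 1 ≤ k) {P : MvPolynomial (Fin k ⊕ Fin k) ℤ}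
    (hP : IsPk k P) : P ∈ Ideal.span (X '' Set.range Sum.inl : Set (MvPolynomial _ ℤ)) := by
  refine mem_span_X_of_aeval_esymmAt Sum.inr (Sum.elim 0 X) (by simp) (by simp) ?_
  have h := congrArg (aeval (Sum.elim 0 X) :
    MvPolynomial (Fin k ⊕ Fin k) ℤ →ₐ[ℤ] MvPolynomial (Fin k) ℤ).toRingHom hP
  rw [map_esymmAt] at h
  simp only [AlgHom.toRingHom_eq_coe, RingHom.coe_coe, map_mul, aeval_X, Sum.elim_inl,
    Pi.zero_apply, zero_mul, esymmAt_zero_fun _ hk] at h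
  rw [← AlgHom.comp_apply, comp_aeval] at h
  rw [← h]
  congr 2
  ext1 (i | i)
  · have := map_esymmAt (aeval (Sum.elim 0 X) :
      MvPolynomial (Fin k ⊕ Fin k) ℤ →ₐ[ℤ] MvPolynomial (Fin k) ℤ).toRingHom Finset.univ (i.1 + 1)
      (fun j : Fin k => (X (Sum.inl j) : MvPolynomial (Fin k ⊕ Fin k) ℤ))
    simp [esymmAt_zero_fun] at this
    simp [this]
  · have := map_esymmAt (aeval (Sum.elim 0 X) :
      MvPolynomial (Fin k ⊕ Fin k) ℤ →ₐ[ℤ] MvPolynomial (Fin k) ℤ).toRingHom Finset.univ (i.1 + 1)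
      (fun j : Fin k => (X (Sum.inr j) : MvPolynomial (Fin k ⊕ Fin k) ℤ))
    simp at this
    simp [this]

lemma IsPk.mem_span_inr {k : ℕ} (hk : 1 ≤ k) {P : MvPolynomial (Fin k ⊕ Fin k) ℤ}
    (hP : IsPk k P) : P ∈ Ideal.span (X '' Set.range Sum.inr : Set (MvPolynomial _ ℤ)) := by
  refine mem_span_X_of_aeval_esymmAt Sum.inl (Sum.elim X 0) (by simp) (by simp) ?_
  have h := congrArg (aeval (Sum.elim X 0) :
    MvPolynomial (Fin k ⊕ Fin k) ℤ →ₐ[ℤ] MvPolynomial (Fin k) ℤ).toRingHom hP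
  rw [map_esymmAt] at h
  simp only [AlgHom.toRingHom_eq_coe, RingHom.coe_coe, map_mul, aeval_X, Sum.elim_inr,
    Pi.zero_apply, mul_zero, esymmAt_zero_fun _ hk] at h
  rw [← AlgHom.comp_apply, comp_aeval] at h
  rw [← h]
  congr 2
  ext1 (i | i)
  · have := map_esymmAt (aeval (Sum.elim X 0) :
      MvPolynomial (Fin k ⊕ Fin k) ℤ →ₐ[ℤ] MvPolynomial (Fin k) ℤ).toRingHom Finset.univ (i.1 + 1)
      (fun j : Fin k => (X (Sum.inl j) : MvPolynomial (Fin k ⊕ Fin k) ℤ))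
    simp at this
    simp [this]
  · have := map_esymmAt (aeval (Sum.elim X 0) :
      MvPolynomial (Fin k ⊕ Fin k) ℤ →ₐ[ℤ] MvPolynomial (Fin k) ℤ).toRingHom Finset.univ (i.1 + 1)
      (fun j : Fin k => (X (Sum.inr j) : MvPolynomial (Fin k ⊕ Fin k) ℤ))
    simp [esymmAt_zero_fun] at this
    simp [this]

lemma IsPkl.mem_span {k m : ℕ} (hk : 1 ≤ k) (hm : 1 ≤ m) {Q : MvPolynomial (Fin (k * m)) ℤ}
    (hQ : IsPkl k m Q) : Q ∈ Ideal.span (X '' {i | m ≤ i.1 + 1} : Set (MvPolynomial _ ℤ)) := by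
  have hle : m - 1 ≤ k * m := (Nat.sub_le _ _).trans (Nat.le_mul_of_pos_left m hk)
  let φ : Fin (k * m) → MvPolynomial (Fin (m - 1)) ℤ := fun i =>
    if h : i.1 < m - 1 then X ⟨i.1, h⟩ else 0
  let s : Finset (Fin (k * m)) := Finset.univ.map (Fin.castLEEmb hle)
  have hs : ∀ i : Fin (k * m), i ∉ s → φ i = 0 := by
    intro i hi
    refine dif_neg fun h => hi ?_
    exact Finset.mem_map.2 ⟨⟨i.1, h⟩, Finset.mem_univ _, rfl⟩
  refine mem_span_X_of_aeval_esymmAt (Fin.castLE hle) φ ?_ ?_ ?_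
  · intro i hi
    exact dif_neg (by have : m ≤ i.1 + 1 := hi; omega)
  · intro i hi
    have hi' : i.1 < m - 1 := by have : ¬ m ≤ i.1 + 1 := hi; omega
    simp [φ, hi']
  have h := congrArg (aeval φ).toRingHom hQ
  rw [map_esymmAt] at h
  simp only [AlgHom.toRingHom_eq_coe, RingHom.coe_coe, map_prod, aeval_X] at h
  rw [← AlgHom.comp_apply, comp_aeval] at h
  have h0 : esymmAt (Finset.univ.powersetCard m) k
      (fun t : Finset (Fin (k * m)) => ∏ i ∈ t, φ i) = 0 := by
    rw [esymmAt_congr (g := fun _ => 0), esymmAt_zero_fun _ hk]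
    intro t ht
    rw [Finset.mem_powersetCard] at ht
    have : ¬ t ⊆ s := fun hts => by
      have := Finset.card_le_card hts
      simp only [s, Finset.card_map, Finset.card_univ, Fintype.card_fin] at this
      omega
    obtain ⟨i, hi, his⟩ := Finset.not_subset.1 this
    exact Finset.prod_eq_zero hi (hs i his)
  rw [h0] at h
  rw [← h]
  congr 2
  funext i
  have h1 := map_esymmAt (aeval φ).toRingHom Finset.univ (i.1 + 1)
    (fun j : Fin (k * m) => (X j : MvPolynomial (Fin (k * m)) ℤ))
  simp only [AlgHom.toRingHom_eq_coe, RingHom.coe_coe, aeval_X] at h1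
  rw [h1, esymmAt_of_subset (Finset.subset_univ s) (fun i _ => hs i), esymmAt_map]
  have h2 : (fun j : Fin (m - 1) => φ (Fin.castLEEmb hle j)) = X := by
    funext j
    simp [φ]
  rw [h2]
  by_cases hi : i.1 < m - 1
  · simp [φ, hi]
  · simp only [φ, hi, dite_false, map_zero]
    exact (esymmAt_eq_zero_of_card_lt (by simp; omega) _).symm

end UniversalPolynomials

section GammaFiltration

variable {R : Type*} [CommRing R] {l : ℕ → R → R}

lemma prod_gammaOp_mem_gammaFil (l : ℕ → R → R) (ε : R →+* ℤ) {m p : ℕ}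
    {is : Fin (p + 1) → ℕ} {a : Fin (p + 1) → R} (his : ∀ j, 1 ≤ is j) (ha : ∀ j, ε (a j) = 0)
    (hm : m ≤ ∑ j, is j) : ∏ j, gammaOp l (is j) (a j) ∈ gammaFil l ε m := by
  cases m with
  | zero => exact AddSubgroup.mem_top _
  | succ m => exact AddSubgroup.subset_closure ⟨p, is, a, his, ha, hm, rfl⟩

lemma gammaOp_mem_gammaFil (l : ℕ → R → R) (ε : R →+* ℤ) {n : ℕ} (hn : 1 ≤ n) {x : R}
    (hx : ε x = 0) : gammaOp l n x ∈ gammaFil l ε n := by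
  simpa using prod_gammaOp_mem_gammaFil l ε (m := n) (p := 0) (is := fun _ => n)
    (a := fun _ => x) (fun _ => hn) (fun _ => hx) (by simp)

lemma gammaFil_succ_le (l : ℕ → R → R) (ε : R →+* ℤ) (m : ℕ) :
    gammaFil l ε (m + 1) ≤ gammaFil l ε m := by
  refine (AddSubgroup.closure_le _).2 ?_
  rintro _ ⟨p, is, a, his, ha, hm, rfl⟩
  exact prod_gammaOp_mem_gammaFil l ε his ha (by omega)

lemma gammaFil_antitone (l : ℕ → R → R) (ε : R →+* ℤ) : Antitone (gammaFil l ε) :=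
  antitone_nat_of_succ_le (gammaFil_succ_le l ε)

lemma mul_mem_gammaFil_succ (l : ℕ → R → R) (ε : R →+* ℤ) {m m' : ℕ} {x y : R}
    (hx : x ∈ gammaFil l ε (m + 1)) (hy : y ∈ gammaFil l ε (m' + 1)) :
    x * y ∈ gammaFil l ε (m + 1 + (m' + 1)) := by
  induction hx using AddSubgroup.closure_induction with
  | mem x hx =>
    obtain ⟨p, is, a, his, ha, hm, rfl⟩ := hx
    induction hy using AddSubgroup.closure_induction with
    | mem y hy =>
      obtain ⟨p', is', a', his', ha', hm', rfl⟩ := hy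
      have hsum := Fin.sum_univ_add (Fin.append is is')
      have hprod := Fin.prod_univ_add fun j =>
        gammaOp l (Fin.append is is' j) (Fin.append a a' j)
      simp only [Fin.append_left, Fin.append_right] at hsum hprod
      have := prod_gammaOp_mem_gammaFil l ε (m := m + 1 + (m' + 1)) (p := p + 1 + p')
        (is := Fin.append (m := p + 1) (n := p' + 1) is is')
        (a := Fin.append (m := p + 1) (n := p' + 1) a a')
        (fun j => by
          refine Fin.addCases (m := p + 1) (n := p' + 1) (fun j => ?_) (fun j => ?_) j
          · simpa using his j
          · simpa using his' j)
        (fun j => by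
          refine Fin.addCases (m := p + 1) (n := p' + 1) (fun j => ?_) (fun j => ?_) j
          · simpa using ha j
          · simpa using ha' j)
        ((add_le_add hm hm').trans hsum.ge)
      exact hprod ▸ this
    | zero => simp
    | add y z _ _ h1 h2 => simpa only [mul_add] using add_mem h1 h2
    | neg y _ h => simpa only [mul_neg] using neg_mem h
  | zero => simp
  | add x z _ _ h1 h2 => simpa only [add_mul] using add_mem h1 h2
  | neg x _ h => simpa only [neg_mul] using neg_mem h

namespace IsLambdaRing

lemma mul_mem_gammaFil_left (hl : IsLambdaRing l) (ε : R →+* ℤ) {m : ℕ} (r : R) {x : R}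
    (hx : x ∈ gammaFil l ε m) : r * x ∈ gammaFil l ε m := by
  cases m with
  | zero => exact AddSubgroup.mem_top _
  | succ m =>
    have h : r - (ε r : R) ∈ gammaFil l ε (0 + 1) := by
      have := gammaOp_mem_gammaFil l ε (n := 1) le_rfl (x := r - (ε r : R)) (by simp)
      simpa [gammaOp, hl.map_one] using this
    have h2 := gammaFil_antitone l ε (by omega : m + 1 ≤ 0 + 1 + (m + 1))
      (mul_mem_gammaFil_succ l ε h hx)
    have h3 := add_mem h2 (zsmul_mem hx (ε r))
    rwa [zsmul_eq_mul, ← add_mul, sub_add_cancel] at h3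

/-- The `m`-th step of the γ-filtration, as an ideal. -/
noncomputable def gammaIdeal (hl : IsLambdaRing l) (ε : R →+* ℤ) (m : ℕ) : Ideal R :=
  { (gammaFil l ε m).toAddSubmonoid with
    smul_mem' := fun r _ hx => hl.mul_mem_gammaFil_left ε r hx }

lemma mem_gammaIdeal (hl : IsLambdaRing l) {ε : R →+* ℤ} {m : ℕ} {x : R} :
    x ∈ hl.gammaIdeal ε m ↔ x ∈ gammaFil l ε m := Iff.rfl

lemma mul_mem_gammaFil (hl : IsLambdaRing l) (ε : R →+* ℤ) {m m' : ℕ} {x y : R}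
    (hx : x ∈ gammaFil l ε m) (hy : y ∈ gammaFil l ε m') :
    x * y ∈ gammaFil l ε (m + m') := by
  rcases m with _ | m
  · rw [zero_add]
    exact hl.mul_mem_gammaFil_left ε x hy
  rcases m' with _ | m'
  · rw [mul_comm]
    exact hl.mul_mem_gammaFil_left ε y hx
  exact mul_mem_gammaFil_succ l ε hx hy

lemma lambda_add_one (hl : IsLambdaRing l) (n : ℕ) (x : R) :
    l (n + 1) (x + 1) = l (n + 1) x + l n x := by
  rw [add_comm x, hl.add_eq, Finset.sum_range_succ', Finset.sum_range_succ',
    Finset.sum_eq_zero]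
  · simp [hl.map_zero, hl.map_one, add_comm]
  · intro i _
    rw [hl.one_eq _ (by omega), zero_mul]

lemma lambda_zero (hl : IsLambdaRing l) {n : ℕ} (hn : 1 ≤ n) : l n (0 : R) = 0 := by
  induction n, hn using Nat.le_induction with
  | base => exact hl.map_one 0
  | succ n hn ih =>
    have h := hl.lambda_add_one n 0
    rw [zero_add, hl.one_eq _ (by omega), ih, add_zero] at h
    exact h.symm

lemma lambda_add_natCast_mem_gammaFil (hl : IsLambdaRing l) (ε : R →+* ℤ) {x : R}
    (hx : ε x = 0) (k d : ℕ) : l (k + 1 + d) (x + (k : R)) ∈ gammaFil l ε (k + 1) := by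
  induction d generalizing k with
  | zero => simpa [gammaOp] using gammaOp_mem_gammaFil l ε (n := k + 1) (by omega) hx
  | succ d ih =>
    have h := hl.lambda_add_one (k + 1 + d) (x + k)
    have h1 := gammaFil_succ_le l ε _ (ih (k + 1))
    rw [show k + 1 + 1 + d = k + 1 + d + 1 by ring, Nat.cast_succ, ← add_assoc, h] at h1
    simpa [← add_assoc] using sub_mem h1 (ih k)

/-- All positive λ-operations of `γ^k(x)` lie in `F^k R`. -/
lemma lambda_gammaOp_mem (hl : IsLambdaRing l) (ε : R →+* ℤ) {x : R} (hx : ε x = 0)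
    {k : ℕ} (hk : 1 ≤ k) {n : ℕ} (hn : 1 ≤ n) : l n (gammaOp l k x) ∈ gammaFil l ε k := by
  obtain ⟨Q, hQ⟩ := exists_isPkl n k
  rw [gammaOp, hl.comp_eq n k hn hk Q hQ, ← hl.mem_gammaIdeal]
  have hspan : Ideal.span (X '' {i | k ≤ i.1 + 1} : Set (MvPolynomial (Fin (n * k)) ℤ)) ≤
      (hl.gammaIdeal ε k).comap
        (aeval fun i : Fin (n * k) => l (i.1 + 1) (x + ((k - 1 : ℕ) : R))).toRingHom := by
    rw [Ideal.span_le]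
    rintro _ ⟨i, hi, rfl⟩
    have h := hl.lambda_add_natCast_mem_gammaFil ε hx (k - 1) (i.1 + 1 - k)
    have hi' : k ≤ i.1 + 1 := hi
    rw [show k - 1 + 1 + (i.1 + 1 - k) = i.1 + 1 by omega, Nat.sub_add_cancel hk] at h
    simpa [hl.mem_gammaIdeal] using h
  exact hspan (hQ.mem_span hn hk)

lemma lambda_mul_mem (hl : IsLambdaRing l) (ε : R →+* ℤ) {a b : ℕ} {x y : R}
    (hx : ∀ n, 1 ≤ n → l n x ∈ gammaFil l ε a) (hy : ∀ n, 1 ≤ n → l n y ∈ gammaFil l ε b)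
    {n : ℕ} (hn : 1 ≤ n) : l n (x * y) ∈ gammaFil l ε (a + b) := by
  obtain ⟨P, hP⟩ := exists_isPk n
  rw [hl.mul_eq n hn P hP, aeval_def, eval₂_eq]
  refine sum_mem fun d hd => hl.mul_mem_gammaFil_left ε _ ?_
  obtain ⟨_, ⟨i, rfl⟩, hi⟩ := mem_ideal_span_X_image.1 (hP.mem_span_inl hn) d hd
  obtain ⟨_, ⟨j, rfl⟩, hj⟩ := mem_ideal_span_X_image.1 (hP.mem_span_inr hn) d hd
  rw [Finset.prod_subset (Finset.subset_univ d.support)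
    (fun i _ hi => by rw [Finsupp.notMem_support_iff.1 hi, pow_zero]), Fintype.prod_sum_type]
  refine hl.mul_mem_gammaFil ε ?_ ?_
  · exact hl.mem_gammaIdeal.1 (Ideal.mem_of_dvd _ (Finset.dvd_prod_of_mem _ (Finset.mem_univ i))
      (Ideal.pow_mem_of_mem _ (hl.mem_gammaIdeal.2 (hx (i.1 + 1) (by omega))) _
        (Nat.pos_of_ne_zero hi)))
  · exact hl.mem_gammaIdeal.1 (Ideal.mem_of_dvd _ (Finset.dvd_prod_of_mem _ (Finset.mem_univ j))
      (Ideal.pow_mem_of_mem _ (hl.mem_gammaIdeal.2 (hy (j.1 + 1) (by omega))) _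
        (Nat.pos_of_ne_zero hj)))

lemma lambda_prod_gammaOp_mem (hl : IsLambdaRing l) (ε : R →+* ℤ) {p : ℕ}
    (is : Fin (p + 1) → ℕ) (a : Fin (p + 1) → R) (his : ∀ j, 1 ≤ is j) (ha : ∀ j, ε (a j) = 0)
    (n : ℕ) (hn : 1 ≤ n) :
    l n (∏ j, gammaOp l (is j) (a j)) ∈ gammaFil l ε (∑ j, is j) := by
  induction p generalizing n with
  | zero => simpa using hl.lambda_gammaOp_mem ε (ha 0) (his 0) hn
  | succ p ih =>
    rw [Fin.prod_univ_succ, Fin.sum_univ_succ]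
    exact hl.lambda_mul_mem ε (fun n hn => hl.lambda_gammaOp_mem ε (ha 0) (his 0) hn)
      (fun n hn => ih _ _ (fun j => his j.succ) (fun j => ha j.succ) n hn) hn

lemma lambda_mem_gammaFil (hl : IsLambdaRing l) (ε : R →+* ℤ) {m : ℕ} {x : R}
    (hx : x ∈ gammaFil l ε m) : ∀ n, 1 ≤ n → l n x ∈ gammaFil l ε m := by
  cases m with
  | zero => exact fun _ _ => AddSubgroup.mem_top _
  | succ m =>
    induction hx using AddSubgroup.closure_induction with
    | mem x hx =>
      obtain ⟨p, is, a, his, ha, hm, rfl⟩ := hx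
      exact fun n hn => gammaFil_antitone l ε hm (hl.lambda_prod_gammaOp_mem ε is a his ha n hn)
    | zero =>
      intro n hn
      rw [hl.lambda_zero hn]
      exact zero_mem _
    | add x y _ _ hx hy =>
      intro n hn
      rw [hl.add_eq]
      refine sum_mem fun i _ => ?_
      rcases Nat.eq_zero_or_pos i with rfl | hi
      · exact hl.mul_mem_gammaFil_left ε _ (hy _ hn)
      · rw [mul_comm]
        exact hl.mul_mem_gammaFil_left ε _ (hx i hi)
    | neg x _ hx =>
      intro n hn
      have h := hl.add_eq n x (-x)
      rw [add_neg_cancel, hl.lambda_zero hn, Finset.sum_range_succ', hl.map_zero, one_mul,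
        Nat.sub_zero] at h
      rw [eq_neg_of_add_eq_zero_right h.symm]
      refine neg_mem (sum_mem fun i _ => ?_)
      rw [mul_comm]
      exact hl.mul_mem_gammaFil_left ε _ (hx _ (by omega))

end IsLambdaRing

end GammaFiltration

/-- basic properties of the γ-filtration of a λ-ring `R` with augmentation
`ε : R → ℤ` commuting with the λ-operations (`ℤ` carrying its canonical λ-ring structure
`λ^n(m) = binom(m,n)`): it is decreasing, multiplicative, and each `F^m R` (`m ≥ 1`) is a
λ-ideal. -/
theorem stmt_7 {R : Type*} [CommRing R] (l : ℕ → R → R) (hl : IsLambdaRing l)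
    (ε : R →+* ℤ) (hε : ∀ (n : ℕ) (r : R), ε (l n r) = Ring.choose (ε r) n) :
    (∀ m, gammaFil l ε (m + 1) ≤ gammaFil l ε m) ∧
    (gammaFil l ε 1 ≤ gammaFil l ε 0 ∧ gammaFil l ε 0 = ⊤) ∧
    (∀ (m m' : ℕ) (x y : R), x ∈ gammaFil l ε m → y ∈ gammaFil l ε m' →
      x * y ∈ gammaFil l ε (m + m')) ∧
    (∀ m, 1 ≤ m →
      (∀ r x : R, x ∈ gammaFil l ε m → r * x ∈ gammaFil l ε m) ∧
      (∀ n, 1 ≤ n → ∀ x : R, x ∈ gammaFil l ε m → l n x ∈ gammaFil l ε m)) := by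
  refine ⟨gammaFil_succ_le l ε, ⟨le_top, rfl⟩, fun m m' x y hx hy => hl.mul_mem_gammaFil ε hx hy,
    fun m _ => ⟨fun r x hx => hl.mul_mem_gammaFil_left ε r hx, fun n hn x hx => ?_⟩⟩
  exact hl.lambda_mem_gammaFil ε hx n hn
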